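/- Fix β₀ ∈ (3/2, (3+λ)/2) and ε₀ ∈ (0, 1/(λ−1)). Let Ĝ : (0,∞) × S → ℂ be continuous and suppose there are constants κ > 0 and a > 0 such that |Ĝ(t,ξ)| ≤ κ e^{−a√|ξ| · t} for all 0 < t ≤ 1 and ξ ∈ S, and |Ĝ(t,ξ)| ≤ κ t^{−1/(λ−1)+ε₀} e^{−a√|ξ|} for all t ≥ 1 and ξ ∈ S. Define G(t,X) = (1/√(2π)) ∫_ℝ e^{iX(r+iβ₀)} Ĝ(t, r + iβ₀) dr for t > 0 and X ∈ ℝ. Then for each t > 0 the function X ↦ G(t,X) is infinitely differentiable on ℝ, and for every integer ℓ ≥ 0 and every R > 0 there are constants C_{ℓ,R} and C'_{ℓ,R} such that |∂_X^ℓ G(t,X)| ≤ C_{ℓ,R} · t^{−2(1+ℓ)} for all 0 < t ≤ 1 and |X| ≤ R, and |∂_X^ℓ G(t,X)| ≤ C'_{ℓ,R} · t^{−1/(λ−1)+ε₀} for all t ≥ 1 and |X| ≤ R. -/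

import Mathlib

open MeasureTheory Real Set Filter

/-- The strip `S = {ξ : 3/2 < Im ξ < (3+λ)/2}`. -/
def strip (lam : ℝ) : Set ℂ := {ξ : ℂ | 3/2 < ξ.im ∧ ξ.im < (3 + lam)/2}

/-- The horizontal line `Im ξ = β` parametrized by the real part. -/
noncomputable def horizontalLine (β r : ℝ) : ℂ := (r : ℂ) + (β : ℂ) * Complex.I

/-- The `ℓ`-th formal derivative in `X` of the Fourier integral of `h` along `Im ξ = β`. -/
noncomputable def lineFourierIntegral (β : ℝ) (h : ℝ → ℂ) (ℓ : ℕ) (X : ℝ) : ℂ :=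
  ∫ r : ℝ, (Complex.I * horizontalLine β r) ^ ℓ *
    (Complex.exp (Complex.I * (X : ℂ) * horizontalLine β r) * h r)

lemma continuous_horizontalLine (β : ℝ) : Continuous (horizontalLine β) := by
  unfold horizontalLine
  fun_prop

lemma horizontalLine_im (β r : ℝ) : (horizontalLine β r).im = β := by
  simp [horizontalLine]

lemma abs_le_norm_horizontalLine (β r : ℝ) : |r| ≤ ‖horizontalLine β r‖ := by
  simpa [horizontalLine] using Complex.abs_re_le_norm (horizontalLine β r)

lemma norm_exp_mul_horizontalLine_le {β R X : ℝ} (hβ : 0 ≤ β) (hX : |X| ≤ R) (r : ℝ) :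
    ‖Complex.exp (Complex.I * (X : ℂ) * horizontalLine β r)‖ ≤ Real.exp (β * R) := by
  rw [Complex.norm_exp]
  have hre : (Complex.I * (X : ℂ) * horizontalLine β r).re = -(X * β) := by
    simp [horizontalLine]
  rw [hre]
  gcongr
  nlinarith [neg_abs_le X]

lemma pow_mul_exp_neg_le_factorial {s : ℝ} (hs : 0 ≤ s) (n : ℕ) :
    s ^ n * Real.exp (-s) ≤ n.factorial := by
  have h := Real.pow_div_factorial_le_exp s hs n
  rw [div_le_iff₀ (by positivity)] at h
  rw [Real.exp_neg, mul_inv_le_iff₀ (Real.exp_pos s)]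
  linarith

lemma pow_mul_exp_neg_sqrt_le {b x : ℝ} (hb : 0 < b) (hx : 0 ≤ x) (r : ℝ) (hr : |r| ≤ x) (ℓ : ℕ) :
    x ^ ℓ * Real.exp (-b * Real.sqrt x) ≤
      ((2 * ℓ).factorial + (2 * ℓ + 4).factorial) * (b ^ (2 * ℓ))⁻¹ *
        (1 + (b ^ 2 * r) ^ 2)⁻¹ := by
  have hs : 0 ≤ b * Real.sqrt x := by positivity
  have h1 := pow_mul_exp_neg_le_factorial hs (2 * ℓ)
  have h2 := pow_mul_exp_neg_le_factorial hs (2 * ℓ + 4)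
  have hsq : (b * Real.sqrt x) ^ 2 = b ^ 2 * x := by rw [mul_pow, Real.sq_sqrt hx]
  have e1 : (b * Real.sqrt x) ^ (2 * ℓ) = b ^ (2 * ℓ) * x ^ ℓ := by
    rw [pow_mul, hsq, mul_pow, ← pow_mul]
  have e2 : (b * Real.sqrt x) ^ (2 * ℓ + 4) = b ^ (2 * ℓ) * x ^ ℓ * (b ^ 2 * x) ^ 2 := by
    rw [pow_add, e1, ← hsq]
    ring
  rw [e1] at h1
  rw [e2] at h2
  have hrx : (b ^ 2 * r) ^ 2 ≤ (b ^ 2 * x) ^ 2 := by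
    rw [mul_pow, mul_pow, ← sq_abs r]
    gcongr
  rw [← div_eq_mul_inv, ← div_eq_mul_inv, le_div_iff₀ (by positivity),
    le_div_iff₀ (by positivity), neg_mul]
  have hP : 0 ≤ b ^ (2 * ℓ) * x ^ ℓ * Real.exp (-(b * Real.sqrt x)) := by positivity
  nlinarith [mul_le_mul_of_nonneg_left hrx hP]

section LineFourierIntegral

variable {β M b : ℝ} {h : ℝ → ℂ}

lemma norm_lineFourierIntegrand_le (hβ : 0 ≤ β) (hM : 0 ≤ M) (hb : 0 < b)
    (hh : ∀ r, ‖h r‖ ≤ M * Real.exp (-b * Real.sqrt ‖horizontalLine β r‖))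
    (ℓ : ℕ) {R X : ℝ} (hX : |X| ≤ R) (r : ℝ) :
    ‖(Complex.I * horizontalLine β r) ^ ℓ *
      (Complex.exp (Complex.I * (X : ℂ) * horizontalLine β r) * h r)‖ ≤
    Real.exp (β * R) * M * (((2 * ℓ).factorial + (2 * ℓ + 4).factorial) * (b ^ (2 * ℓ))⁻¹) *
      (1 + (b ^ 2 * r) ^ 2)⁻¹ := by
  rw [norm_mul, norm_mul, norm_pow, norm_mul, Complex.norm_I, one_mul]
  calc ‖horizontalLine β r‖ ^ ℓ *
        (‖Complex.exp (Complex.I * (X : ℂ) * horizontalLine β r)‖ * ‖h r‖)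
      ≤ ‖horizontalLine β r‖ ^ ℓ *
        (Real.exp (β * R) * (M * Real.exp (-b * Real.sqrt ‖horizontalLine β r‖))) := by
        gcongr
        · exact norm_exp_mul_horizontalLine_le hβ hX r
        · exact hh r
    _ = Real.exp (β * R) * M *
        (‖horizontalLine β r‖ ^ ℓ * Real.exp (-b * Real.sqrt ‖horizontalLine β r‖)) := by ring
    _ ≤ Real.exp (β * R) * M * (((2 * ℓ).factorial + (2 * ℓ + 4).factorial) * (b ^ (2 * ℓ))⁻¹ *
        (1 + (b ^ 2 * r) ^ 2)⁻¹) := by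
        exact mul_le_mul_of_nonneg_left
          (pow_mul_exp_neg_sqrt_le hb (norm_nonneg _) r (abs_le_norm_horizontalLine β r) ℓ)
          (by positivity)
    _ = _ := by ring

lemma integrable_inv_one_add_mul_sq (hb : 0 < b) :
    Integrable fun r : ℝ => (1 + (b ^ 2 * r) ^ 2)⁻¹ :=
  integrable_inv_one_add_sq.comp_mul_left' (by positivity)

lemma continuous_lineFourierIntegrand (hc : Continuous h) (ℓ : ℕ) (X : ℝ) :
    Continuous fun r : ℝ => (Complex.I * horizontalLine β r) ^ ℓ *
      (Complex.exp (Complex.I * (X : ℂ) * horizontalLine β r) * h r) := by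
  have := continuous_horizontalLine β
  fun_prop

lemma hasDerivAt_lineFourierIntegral (hβ : 0 ≤ β) (hM : 0 ≤ M) (hb : 0 < b) (hc : Continuous h)
    (hh : ∀ r, ‖h r‖ ≤ M * Real.exp (-b * Real.sqrt ‖horizontalLine β r‖)) (ℓ : ℕ) (X : ℝ) :
    HasDerivAt (lineFourierIntegral β h ℓ) (lineFourierIntegral β h (ℓ + 1) X) X := by
  have hint := (integrable_inv_one_add_mul_sq hb).const_mul
    (Real.exp (β * |X|) * M * (((2 * ℓ).factorial + (2 * ℓ + 4).factorial) * (b ^ (2 * ℓ))⁻¹))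
  have hint' := (integrable_inv_one_add_mul_sq hb).const_mul
    (Real.exp (β * (|X| + 1)) * M *
      (((2 * (ℓ + 1)).factorial + (2 * (ℓ + 1) + 4).factorial) * (b ^ (2 * (ℓ + 1)))⁻¹))
  refine (hasDerivAt_integral_of_dominated_loc_of_deriv_le
    (F' := fun Y r => (Complex.I * horizontalLine β r) ^ (ℓ + 1) *
      (Complex.exp (Complex.I * (Y : ℂ) * horizontalLine β r) * h r))
    (Metric.ball_mem_nhds X one_pos)
    (Eventually.of_forall fun Y => (continuous_lineFourierIntegrand hc ℓ Y).aestronglyMeasurable)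
    (hint.mono' (continuous_lineFourierIntegrand hc ℓ X).aestronglyMeasurable
      (Eventually.of_forall fun r => norm_lineFourierIntegrand_le hβ hM hb hh ℓ le_rfl r))
    (continuous_lineFourierIntegrand hc (ℓ + 1) X).aestronglyMeasurable
    (Eventually.of_forall fun r Y hY =>
      norm_lineFourierIntegrand_le hβ hM hb hh (ℓ + 1) (R := |X| + 1) ?_ r) hint'
    (Eventually.of_forall fun r Y _ => ?_)).2
  · rw [Metric.mem_ball, Real.dist_eq] at hY
    linarith [abs_sub_abs_le_abs_sub Y X]
  · have h1 : HasDerivAt (fun Y : ℝ => Complex.I * (Y : ℂ) * horizontalLine β r)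
        (Complex.I * 1 * horizontalLine β r) Y :=
      ((Complex.ofRealCLM.hasDerivAt (x := Y)).const_mul Complex.I).mul_const _
    refine ((h1.cexp.mul_const (h r)).const_mul
      ((Complex.I * horizontalLine β r) ^ ℓ)).congr_deriv ?_
    ring

lemma iteratedDeriv_lineFourierIntegral (hβ : 0 ≤ β) (hM : 0 ≤ M) (hb : 0 < b)
    (hc : Continuous h)
    (hh : ∀ r, ‖h r‖ ≤ M * Real.exp (-b * Real.sqrt ‖horizontalLine β r‖)) (ℓ : ℕ) :
    iteratedDeriv ℓ (lineFourierIntegral β h 0) = lineFourierIntegral β h ℓ := by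
  induction ℓ with
  | zero => exact iteratedDeriv_zero
  | succ ℓ ih =>
    rw [iteratedDeriv_succ, ih]
    exact funext fun X => (hasDerivAt_lineFourierIntegral hβ hM hb hc hh ℓ X).deriv

lemma contDiff_lineFourierIntegral (hβ : 0 ≤ β) (hM : 0 ≤ M) (hb : 0 < b) (hc : Continuous h)
    (hh : ∀ r, ‖h r‖ ≤ M * Real.exp (-b * Real.sqrt ‖horizontalLine β r‖)) :
    ContDiff ℝ (⊤ : ℕ∞) (lineFourierIntegral β h 0) := by
  refine contDiff_of_differentiable_iteratedDeriv fun m _ => ?_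
  rw [iteratedDeriv_lineFourierIntegral hβ hM hb hc hh]
  exact fun X => (hasDerivAt_lineFourierIntegral hβ hM hb hc hh m X).differentiableAt

lemma norm_lineFourierIntegral_le (hβ : 0 ≤ β) (hM : 0 ≤ M) (hb : 0 < b)
    (hh : ∀ r, ‖h r‖ ≤ M * Real.exp (-b * Real.sqrt ‖horizontalLine β r‖))
    (ℓ : ℕ) {R X : ℝ} (hX : |X| ≤ R) :
    ‖lineFourierIntegral β h ℓ X‖ ≤ M *
      (Real.exp (β * R) * ((2 * ℓ).factorial + (2 * ℓ + 4).factorial) * π) *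
        (b ^ (2 * (1 + ℓ)))⁻¹ := by
  refine (norm_integral_le_of_norm_le ((integrable_inv_one_add_mul_sq hb).const_mul _)
    (Eventually.of_forall fun r =>
      norm_lineFourierIntegrand_le hβ hM hb hh ℓ hX r)).trans_eq ?_
  have hpow : b ^ (2 * (1 + ℓ)) = b ^ 2 * b ^ (2 * ℓ) := by ring
  rw [integral_const_mul,
    Measure.integral_comp_mul_left (fun y : ℝ => (1 + y ^ 2)⁻¹) (b ^ 2),
    integral_univ_inv_one_add_sq, abs_of_pos (by positivity), smul_eq_mul, hpow, mul_inv]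
  ring

end LineFourierIntegral

theorem smoothness_and_bounds_of_inverse_fourier_transform
    (lam : ℝ) (hlam1 : 1 < lam) (hlam2 : lam < 2)
    (β₀ : ℝ) (hβ₀ : β₀ ∈ Ioo (3/2 : ℝ) ((3 + lam)/2))
    (ε₀ : ℝ) (hε₀ : 0 < ε₀) (hε₀' : ε₀ < 1/(lam - 1))
    (Ghat : ℝ → ℂ → ℂ)
    (hcont : ContinuousOn (fun p : ℝ × ℂ => Ghat p.1 p.2) (Ioi 0 ×ˢ strip lam))
    (κ a : ℝ) (hκ : 0 < κ) (ha : 0 < a)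
    (hsmall : ∀ t : ℝ, 0 < t → t ≤ 1 → ∀ ξ ∈ strip lam,
      ‖Ghat t ξ‖ ≤ κ * Real.exp (-a * Real.sqrt ‖ξ‖ * t))
    (hlarge : ∀ t : ℝ, 1 ≤ t → ∀ ξ ∈ strip lam,
      ‖Ghat t ξ‖ ≤ κ * t ^ (-1/(lam - 1) + ε₀) * Real.exp (-a * Real.sqrt ‖ξ‖))
    (G : ℝ → ℝ → ℂ)
    (hG : ∀ t X : ℝ, G t X = ((1 / Real.sqrt (2 * π) : ℝ) : ℂ) *
      ∫ r : ℝ, Complex.exp (Complex.I * (X : ℂ) * ((r : ℂ) + (β₀ : ℂ) * Complex.I))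
        * Ghat t ((r : ℂ) + (β₀ : ℂ) * Complex.I)) :
    (∀ t : ℝ, 0 < t → ContDiff ℝ (⊤ : ℕ∞) (fun X => G t X)) ∧
    ∀ ℓ : ℕ, ∀ R : ℝ, 0 < R → ∃ C > (0:ℝ), ∃ C' > (0:ℝ),
      (∀ t : ℝ, 0 < t → t ≤ 1 → ∀ X : ℝ, |X| ≤ R →
        ‖iteratedDeriv ℓ (fun Y => G t Y) X‖ ≤ C * t ^ (-(2:ℝ) * (1 + (ℓ : ℝ)))) ∧
      (∀ t : ℝ, 1 ≤ t → ∀ X : ℝ, |X| ≤ R →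
        ‖iteratedDeriv ℓ (fun Y => G t Y) X‖ ≤ C' * t ^ (-1/(lam - 1) + ε₀)) := by
  have hβ : 0 ≤ β₀ := by linarith [hβ₀.1]
  have hmem : ∀ r, horizontalLine β₀ r ∈ strip lam := fun r => by
    simpa [strip, horizontalLine_im] using hβ₀
  have hc : ∀ t : ℝ, 0 < t → Continuous fun r => Ghat t (horizontalLine β₀ r) := fun t ht =>
    hcont.comp_continuous (continuous_const.prodMk (continuous_horizontalLine β₀))
      fun r => ⟨ht, hmem r⟩
  have hGt : ∀ t, (fun X => G t X) = fun X => ((1 / Real.sqrt (2 * π) : ℝ) : ℂ) *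
      lineFourierIntegral β₀ (fun r => Ghat t (horizontalLine β₀ r)) 0 X := fun t => by
    funext X
    simp [hG, lineFourierIntegral, horizontalLine]
  have hs : ∀ t : ℝ, 0 < t → t ≤ 1 → ∀ r, ‖Ghat t (horizontalLine β₀ r)‖ ≤
      κ * Real.exp (-(a * t) * Real.sqrt ‖horizontalLine β₀ r‖) := fun t ht ht1 r => by
    convert hsmall t ht ht1 _ (hmem r) using 3
    ring
  have hl : ∀ t : ℝ, 1 ≤ t → ∀ r, ‖Ghat t (horizontalLine β₀ r)‖ ≤
      κ * t ^ (-1/(lam - 1) + ε₀) * Real.exp (-a * Real.sqrt ‖horizontalLine β₀ r‖) :=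
    fun t ht r => hlarge t ht _ (hmem r)
  have hconst : ‖((1 / Real.sqrt (2 * π) : ℝ) : ℂ)‖ ≤ 1 := by
    rw [Complex.norm_real, Real.norm_of_nonneg (by positivity)]
    refine div_le_one_of_le₀ ?_ (by positivity)
    rw [Real.one_le_sqrt]
    linarith [Real.pi_gt_three]
  have hbound : ∀ {M b t : ℝ}, 0 ≤ M → 0 < b → 0 < t →
      (∀ r, ‖Ghat t (horizontalLine β₀ r)‖ ≤
        M * Real.exp (-b * Real.sqrt ‖horizontalLine β₀ r‖)) →
      ∀ (ℓ : ℕ) {R X : ℝ}, |X| ≤ R → ‖iteratedDeriv ℓ (fun Y => G t Y) X‖ ≤ M *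
        (Real.exp (β₀ * R) * ((2 * ℓ).factorial + (2 * ℓ + 4).factorial) * π) *
          (b ^ (2 * (1 + ℓ)))⁻¹ := by
    intro M b t hM hb ht hh ℓ R X hX
    rw [hGt, iteratedDeriv_const_mul_field,
      iteratedDeriv_lineFourierIntegral hβ hM hb (hc t ht) hh, norm_mul]
    exact (mul_le_of_le_one_left (norm_nonneg _) hconst).trans
      (norm_lineFourierIntegral_le hβ hM hb hh ℓ hX)
  refine ⟨fun t ht => ?_, fun ℓ R _ => ?_⟩
  · rw [hGt]
    refine contDiff_const.mul ?_
    rcases le_total t 1 with ht1 | ht1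
    · exact contDiff_lineFourierIntegral hβ hκ.le (mul_pos ha ht) (hc t ht) (hs t ht ht1)
    · exact contDiff_lineFourierIntegral hβ (by positivity) ha (hc t ht) (hl t ht1)
  · set K := Real.exp (β₀ * R) * ((2 * ℓ).factorial + (2 * ℓ + 4).factorial) * π
    have hC : 0 < κ * K * (a ^ (2 * (1 + ℓ)))⁻¹ := by positivity
    refine ⟨_, hC, _, hC, fun t ht ht1 X hX => ?_, fun t ht1 X hX => ?_⟩
    · refine (hbound hκ.le (mul_pos ha ht) ht (hs t ht ht1) ℓ hX).trans_eq ?_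
      have hpow : t ^ (-(2:ℝ) * (1 + (ℓ : ℝ))) = (t ^ (2 * (1 + ℓ)))⁻¹ := by
        rw [neg_mul, Real.rpow_neg ht.le, ← Real.rpow_natCast]
        push_cast
        rfl
      rw [hpow, mul_pow, mul_inv]
      ring
    · have ht : 0 < t := by linarith
      refine (hbound (by positivity) ha ht (hl t ht1) ℓ hX).trans_eq ?_
      ring
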